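/- Fix b ∈ (0,1) and a positive integer s, and for each N set n = ⌊bN⌋. Then: (i) the zeros of t_n(·, N+1) are symmetric about N/2, i.e. if x is a zero of t_n(·, N+1) then so is N - x; and (ii) if for all sufficiently large N the polynomial t_n(·, N+1) has n distinct real zeros x_{N+1,1} < x_{N+1,2} < ⋯ < x_{N+1,n} in (0, N), then the s-th smallest zero satisfies x_{N+1,s} → s - 1 as N → ∞, and consequently the s-th largest zero satisfies N - x_{N+1,n-s+1} → s - 1 as N → ∞. -/

import Mathlib

open Finset Filter

/-- Pochhammer rising factorial `(z)_k = z (z+1) ⋯ (z+k-1)`. -/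
noncomputable def poch (z : ℝ) (k : ℕ) : ℝ := ∏ i ∈ Finset.range k, (z + i)

/-- Discrete Chebyshev polynomial `t_n(x, N+1)` for `0 ≤ n ≤ N`:
`t_n(x, N+1) = (-1)^n (N+1-n)_n ∑_{k=0}^n ((-n)_k (-x)_k (n+1)_k)/((-N)_k (k!)^2)`. -/
noncomputable def tcheb (n N : ℕ) (x : ℝ) : ℝ :=
  (-1 : ℝ) ^ n * poch ((N : ℝ) + 1 - n) n *
    ∑ k ∈ Finset.range (n + 1),
      poch (-(n : ℝ)) k * poch (-x) k * poch ((n : ℝ) + 1) k /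
        (poch (-(N : ℝ)) k * ((Nat.factorial k : ℝ)) ^ 2)


section DiscreteChebyshev

open Polynomial Topology

lemma poch_zero (z : ℝ) : poch z 0 = 1 := by simp [poch]

lemma poch_succ (z : ℝ) (k : ℕ) : poch z (k + 1) = poch z k * (z + k) := by
  simp [poch, Finset.prod_range_succ]

lemma poch_neg_natCast (n k : ℕ) :
    poch (-(n : ℝ)) k = (-1) ^ k * (n.descFactorial k : ℝ) := by
  induction k with
  | zero => simp [poch_zero]
  | succ k ih =>
    rw [poch_succ, ih, Nat.descFactorial_succ]
    rcases le_or_gt k n with h | h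
    · push_cast [Nat.cast_sub h]
      ring
    · simp [Nat.descFactorial_eq_zero_iff_lt.2 h]

lemma poch_natCast_add_one (n k : ℕ) :
    poch ((n : ℝ) + 1) k = ((n + k).descFactorial k : ℝ) := by
  induction k with
  | zero => simp [poch_zero]
  | succ k ih =>
    rw [poch_succ, ih, ← add_assoc, Nat.succ_descFactorial_succ]
    push_cast
    ring

lemma poch_neg_natCast_ne_zero {N k : ℕ} (h : k ≤ N) : poch (-(N : ℝ)) k ≠ 0 := by
  rw [poch_neg_natCast]
  have : N.descFactorial k ≠ 0 := by
    rw [Ne, Nat.descFactorial_eq_zero_iff_lt]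
    omega
  positivity

lemma sum_descFactorial {m p : ℕ} (h : m ≤ p) (M : ℕ) :
    (∑ x ∈ range M, (x + m).descFactorial p) * (p + 1) = (M + m).descFactorial (p + 1) := by
  induction M with
  | zero => simpa using (Nat.descFactorial_eq_zero_iff_lt.2 (Nat.lt_succ_of_le h)).symm
  | succ M ih =>
    rw [sum_range_succ, add_mul, ih, add_right_comm M 1 m, Nat.succ_descFactorial_succ,
      Nat.descFactorial_succ]
    rcases le_or_gt p (M + m) with h' | h'
    · obtain ⟨c, hc⟩ := Nat.exists_eq_add_of_le h'
      rw [hc, Nat.add_sub_cancel_left]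
      ring
    · simp [Nat.descFactorial_eq_zero_iff_lt.2 h']

lemma sum_poch_mul_poch_div {N k : ℕ} (hk : k ≤ N) (m : ℕ) :
    (∑ x ∈ range (N + 1), poch (-(x : ℝ)) k * poch ((x : ℝ) + 1) m) / poch (-(N : ℝ)) k =
      ((N + 1 + m).descFactorial (m + 1) : ℝ) / (k + 1 + m) := by
  have hsum := sum_descFactorial (Nat.le_add_right m k) (N + 1)
  have hterm (x : ℕ) : poch (-(x : ℝ)) k * poch ((x : ℝ) + 1) m =
      (-1) ^ k * ((x + m).descFactorial (m + k) : ℝ) := by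
    have h := Nat.descFactorial_mul_descFactorial (n := x + m) (Nat.le_add_right m k)
    simp only [Nat.add_sub_cancel, Nat.add_sub_cancel_left] at h
    rw [poch_neg_natCast, poch_natCast_add_one, ← h]
    push_cast
    ring
  have hsplit := Nat.descFactorial_mul_descFactorial (n := N + 1 + m)
    (show m + 1 ≤ m + k + 1 by omega)
  rw [show N + 1 + m - (m + 1) = N by omega, show m + k + 1 - (m + 1) = k by omega,
    ← hsum] at hsplit
  have hsplit' : ((N.descFactorial k : ℝ)) * ((N + 1 + m).descFactorial (m + 1) : ℝ) =
      (∑ x ∈ range (N + 1), ((x + m).descFactorial (m + k) : ℝ)) * (m + k + 1) := by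
    exact_mod_cast hsplit
  simp_rw [hterm, ← mul_sum]
  rw [div_eq_div_iff (poch_neg_natCast_ne_zero hk) (by positivity), poch_neg_natCast]
  linear_combination -(-1 : ℝ) ^ k * hsplit'

lemma sum_neg_one_pow_mul_choose_mul_eval {n : ℕ} {p : ℝ[X]} (hp : p.natDegree < n) :
    ∑ k ∈ range (n + 1), (-1 : ℝ) ^ k * n.choose k * p.eval (k : ℝ) = 0 := by
  have h := congrFun (fwdDiff_iter_eq_zero_of_degree_lt hp) 0
  rw [fwdDiff_iter_eq_sum_shift] at h
  have h2 : (-1 : ℝ) ^ n * ∑ k ∈ range (n + 1),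
      ((-1 : ℤ) ^ (n - k) * n.choose k) • p.eval (0 + k • (1 : ℝ)) = 0 := by
    rw [h]; simp
  rw [← h2, mul_sum]
  refine sum_congr rfl fun k hk => ?_
  have hk' : k ≤ n := Nat.lt_succ_iff.1 (mem_range.1 hk)
  obtain ⟨c, rfl⟩ := Nat.exists_eq_add_of_le hk'
  have hc : ((-1 : ℝ) ^ c) * (-1) ^ c = 1 := by rw [← mul_pow]; simp
  simp only [Nat.add_sub_cancel_left, zero_add, nsmul_eq_mul, mul_one, zsmul_eq_mul]
  push_cast
  rw [pow_add]
  linear_combination -(-1 : ℝ) ^ k * ((k + c).choose k) * p.eval (k : ℝ) * hc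

/-- The discrete Chebyshev polynomial, normalised to take the value `1` at `0`. -/
noncomputable def chebPoly (n N : ℕ) : ℝ[X] :=
  ∑ k ∈ range (n + 1), C (poch (-(n : ℝ)) k * poch ((n : ℝ) + 1) k /
    (poch (-(N : ℝ)) k * (Nat.factorial k : ℝ) ^ 2)) * ∏ i ∈ range k, (C (i : ℝ) - X)

lemma eval_chebPoly (n N : ℕ) (x : ℝ) :
    (chebPoly n N).eval x = ∑ k ∈ range (n + 1),
      poch (-(n : ℝ)) k * poch (-x) k * poch ((n : ℝ) + 1) k /
        (poch (-(N : ℝ)) k * ((Nat.factorial k : ℝ)) ^ 2) := by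
  rw [chebPoly, eval_finsetSum]
  refine sum_congr rfl fun k _ => ?_
  have : (∏ i ∈ range k, (C (i : ℝ) - X)).eval x = poch (-x) k := by
    rw [eval_prod, poch]
    exact prod_congr rfl fun i _ => by simp; ring
  rw [eval_mul, this, eval_C]
  ring

lemma tcheb_eq_zero_iff {n N : ℕ} (h : n ≤ N) (x : ℝ) :
    tcheb n N x = 0 ↔ (chebPoly n N).eval x = 0 := by
  have hpoch : poch ((N : ℝ) + 1 - n) n ≠ 0 := by
    obtain ⟨c, rfl⟩ := Nat.exists_eq_add_of_le h
    rw [show (((n + c : ℕ) : ℝ) + 1 - n) = c + 1 by push_cast; ring, poch_natCast_add_one]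
    have : (c + n).descFactorial n ≠ 0 := by
      rw [Ne, Nat.descFactorial_eq_zero_iff_lt]
      omega
    exact_mod_cast this
  rw [eval_chebPoly, tcheb, mul_eq_zero]
  simp [hpoch]

lemma eval_zero_chebPoly (n N : ℕ) : (chebPoly n N).eval 0 = 1 := by
  rw [eval_chebPoly, sum_eq_single 0]
  · simp [poch_zero]
  · intro k _ hk
    have h : poch 0 k = 0 := by
      have := poch_neg_natCast 0 k
      rw [Nat.descFactorial_eq_zero_iff_lt.2 (Nat.pos_of_ne_zero hk)] at this
      simpa using this
    simp [h]
  · simp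

lemma natDegree_chebPoly_le (n N : ℕ) : (chebPoly n N).natDegree ≤ n := by
  refine natDegree_sum_le_of_forall_le _ _ fun k hk => ?_
  refine (natDegree_C_mul_le _ _).trans ((natDegree_prod_le _ _).trans ?_)
  refine (sum_le_card_nsmul _ _ 1 fun i _ => ?_).trans ?_
  · rw [natDegree_sub]
    exact natDegree_X_sub_C_le _
  · simpa using Nat.lt_succ_iff.1 (mem_range.1 hk)

lemma sum_eval_chebPoly_mul_poch {n N m : ℕ} (hn : n ≤ N) (hm : m < n) :
    ∑ x ∈ range (N + 1), (chebPoly n N).eval (x : ℝ) * poch ((x : ℝ) + 1) m = 0 := by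
  set p : ℝ[X] := ∏ i ∈ (range n).erase m, (X + C (1 + i : ℝ)) with hp
  have hdeg : p.natDegree < n := by
    refine (natDegree_prod_le _ _).trans_lt ?_
    simp only [natDegree_X_add_C, sum_const, card_erase_of_mem (mem_range.2 hm), card_range,
      smul_eq_mul, mul_one]
    omega
  have hpk (k : ℕ) : poch ((k : ℝ) + 1) n = p.eval (k : ℝ) * (k + 1 + m) := by
    rw [hp, eval_prod, poch, ← mul_prod_erase _ _ (mem_range.2 hm), mul_comm]
    congr 1
    exact prod_congr rfl fun i _ => by simp; ring
  have hcoef (k : ℕ) : poch (-(n : ℝ)) k * poch ((n : ℝ) + 1) k / (Nat.factorial k : ℝ) ^ 2 =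
      (-1) ^ k * n.choose k * (p.eval (k : ℝ) * (k + 1 + m)) / n.factorial := by
    have h1 := Nat.factorial_mul_descFactorial (Nat.le_add_left k n)
    have h2 := Nat.factorial_mul_descFactorial (Nat.le_add_left n k)
    rw [Nat.add_sub_cancel] at h1 h2
    have h3 : (n.factorial : ℝ) * ((n + k).descFactorial k : ℝ) =
        k.factorial * ((k + n).descFactorial n : ℝ) := by
      rw [add_comm k n] at h2 ⊢
      exact_mod_cast h1.trans h2.symm
    rw [← hpk, poch_neg_natCast, poch_natCast_add_one, poch_natCast_add_one,
      Nat.descFactorial_eq_factorial_mul_choose n k, div_eq_div_iff (by positivity)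
      (by positivity)]
    push_cast
    linear_combination (-1 : ℝ) ^ k * k.factorial * n.choose k * h3
  calc
    _ = ∑ k ∈ range (n + 1), poch (-(n : ℝ)) k * poch ((n : ℝ) + 1) k /
        (Nat.factorial k : ℝ) ^ 2 * ((∑ x ∈ range (N + 1),
          poch (-(x : ℝ)) k * poch ((x : ℝ) + 1) m) / poch (-(N : ℝ)) k) := by
      simp_rw [eval_chebPoly, sum_mul, sum_div, mul_sum]
      rw [sum_comm]
      refine sum_congr rfl fun k _ => sum_congr rfl fun x _ => ?_
      ring
    _ = ((N + 1 + m).descFactorial (m + 1) : ℝ) / n.factorial *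
        ∑ k ∈ range (n + 1), (-1 : ℝ) ^ k * n.choose k * p.eval (k : ℝ) := by
      rw [mul_sum]
      refine sum_congr rfl fun k hk => ?_
      rw [sum_poch_mul_poch_div (by have := mem_range.1 hk; omega), hcoef]
      have : (k : ℝ) + 1 + m ≠ 0 := by positivity
      field_simp
    _ = 0 := by rw [sum_neg_one_pow_mul_choose_mul_eval hdeg, mul_zero]

/-- Orthogonality of the discrete Chebyshev polynomial to all polynomials of smaller degree. -/
lemma sum_eval_chebPoly_mul_eval {n N : ℕ} (hn : n ≤ N) {q : ℝ[X]} (hq : q.degree < n) :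
    ∑ x ∈ range (N + 1), (chebPoly n N).eval (x : ℝ) * q.eval (x : ℝ) = 0 := by
  suffices ∀ m ≤ n, ∀ q : ℝ[X], q.degree < m →
      ∑ x ∈ range (N + 1), (chebPoly n N).eval (x : ℝ) * q.eval (x : ℝ) = 0 from
    this n le_rfl q hq
  intro m
  induction m with
  | zero =>
    intro _ q hq
    simp [degree_eq_bot.1 (Nat.WithBot.lt_zero_iff.1 hq)]
  | succ m ih =>
    intro hm q hq
    set B : ℝ[X] := ∏ i ∈ range m, (X + C (1 + i : ℝ)) with hB
    have hBmonic : B.Monic := monic_prod_of_monic _ _ fun i _ => monic_X_add_C _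
    have hBdeg : B.natDegree = m := by
      rw [hB, natDegree_prod_of_monic _ _ fun i _ => monic_X_add_C _]
      simp only [natDegree_X_add_C, sum_const, card_range, smul_eq_mul, mul_one]
    have hBeval (x : ℝ) : B.eval x = poch (x + 1) m := by
      rw [hB, eval_prod, poch]
      exact prod_congr rfl fun i _ => by simp; ring
    have hlt : (q - C (q.coeff m) * B).degree < m := by
      rw [degree_lt_iff_coeff_zero] at hq ⊢
      intro k hk
      rw [coeff_sub, coeff_C_mul]
      rcases hk.eq_or_lt with rfl | hk
      · nth_rewrite 3 [← hBdeg]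
        rw [hBmonic.coeff_natDegree]
        ring
      · rw [hq k hk, coeff_eq_zero_of_natDegree_lt (hBdeg.trans_lt hk)]
        ring
    have h1 := ih (by omega) _ hlt
    have h2 := sum_eval_chebPoly_mul_poch hn (show m < n by omega)
    simp only [eval_sub, eval_mul, eval_C, hBeval, mul_sub, sum_sub_distrib] at h1
    rw [sub_eq_zero.1 h1, ← mul_zero (q.coeff m), ← h2, mul_sum]
    exact sum_congr rfl fun x _ => by ring

lemma chebPoly_reflect {n N : ℕ} (hn : n ≤ N) :
    (chebPoly n N).comp (C (N : ℝ) - X) =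
      C ((-1) ^ (chebPoly n N).natDegree) * chebPoly n N := by
  set P := chebPoly n N with hP
  have hP0 : P ≠ 0 := fun h => by simpa [← hP, h] using eval_zero_chebPoly n N
  have hdegY : (C (N : ℝ) - X).natDegree = 1 := by
    rw [natDegree_sub, natDegree_X_sub_C]
  have hlcY : (C (N : ℝ) - X).leadingCoeff = -1 := by
    rw [← neg_sub, leadingCoeff_neg, leadingCoeff_X_sub_C]
  have hlc : (P.comp (C (N : ℝ) - X)).leadingCoeff = (-1) ^ P.natDegree * P.leadingCoeff := by
    rw [leadingCoeff_comp (by omega), hlcY, mul_comm]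
  have hne : P.comp (C (N : ℝ) - X) ≠ 0 := by
    rw [← leadingCoeff_ne_zero, hlc]
    simp [hP0]
  have hdeg : (P.comp (C (N : ℝ) - X)).degree = P.degree := by
    rw [degree_eq_natDegree hne, degree_eq_natDegree hP0, natDegree_comp, hdegY, mul_one]
  set R := P.comp (C (N : ℝ) - X) - C ((-1) ^ P.natDegree) * P with hR
  have hRdeg : R.degree < n := by
    have h : R.degree < (P.comp (C (N : ℝ) - X)).degree := by
      refine degree_sub_lt_left ?_ hne ?_
      · rw [hdeg, degree_C_mul (by simp)]
      · rw [hlc, leadingCoeff_mul, leadingCoeff_C]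
    rw [hdeg] at h
    exact h.trans_le (natDegree_le_iff_degree_le.1 (natDegree_chebPoly_le n N))
  set c : ℝ := (-1) ^ P.natDegree with hc
  have hc2 : c * c = 1 := by rw [hc, ← mul_pow]; simp
  have hReval (x : ℝ) : R.eval x = P.eval (N - x) - c * P.eval x := by
    rw [hR]
    simp [eval_comp]
  have horth := sum_eval_chebPoly_mul_eval hn hRdeg
  rw [← hP] at horth
  have hrefl : ∑ x ∈ range (N + 1), P.eval ((N : ℝ) - x) * R.eval (x : ℝ) = 0 := by
    rw [← sum_range_reflect, ← mul_zero (-c), ← horth, mul_sum]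
    refine sum_congr rfl fun x hx => ?_
    have hx' : x ≤ N := Nat.lt_succ_iff.1 (mem_range.1 hx)
    rw [Nat.add_sub_cancel, Nat.cast_sub hx', hReval, hReval, sub_sub_cancel]
    linear_combination -(P.eval (x : ℝ)) ^ 2 * hc2
  have hsq : ∑ x ∈ range (N + 1), R.eval (x : ℝ) ^ 2 = 0 := by
    have h : ∀ x : ℕ, R.eval (x : ℝ) ^ 2 =
        P.eval ((N : ℝ) - x) * R.eval (x : ℝ) - c * (P.eval (x : ℝ) * R.eval (x : ℝ)) :=
      fun x => by rw [sq]; nth_rewrite 1 [hReval]; ring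
    simp_rw [h, sum_sub_distrib, ← mul_sum]
    rw [hrefl, horth]
    ring
  rw [sum_eq_zero_iff_of_nonneg fun x _ => sq_nonneg _] at hsq
  refine sub_eq_zero.1 (eq_zero_of_degree_lt_of_eval_finset_eq_zero
    ((range (N + 1)).map Nat.castEmbedding) ?_ ?_)
  · rw [card_map, card_range]
    exact hRdeg.trans_le (by exact_mod_cast hn.trans (Nat.le_succ N))
  · intro x hx
    obtain ⟨y, hy, rfl⟩ := mem_map.1 hx
    exact pow_eq_zero_iff two_ne_zero |>.1 (hsq y hy)

lemma tcheb_sub_eq_zero {n N : ℕ} (hn : n ≤ N) {x : ℝ} (hx : tcheb n N x = 0) :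
    tcheb n N (N - x) = 0 := by
  rw [tcheb_eq_zero_iff hn] at hx ⊢
  have h := congrArg (eval x) (chebPoly_reflect hn)
  simpa [eval_comp, hx] using h

/-- `z 1 < ⋯ < z n` is the increasing enumeration of the zeros of `t_n(·, N+1)`, all of which
lie in `(0, N)`. -/
def IsZeroEnum (n N : ℕ) (z : ℕ → ℝ) : Prop :=
  (∀ i ∈ Finset.Icc 1 n, z i ∈ Set.Ioo (0 : ℝ) (N : ℝ) ∧ tcheb n N (z i) = 0) ∧
  (∀ i ∈ Finset.Icc 1 n, ∀ j ∈ Finset.Icc 1 n, i < j → z i < z j) ∧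
  (∀ x : ℝ, tcheb n N x = 0 → ∃ i ∈ Finset.Icc 1 n, x = z i)

namespace IsZeroEnum

variable {n N : ℕ} {z : ℕ → ℝ}

lemma reflect (hn : n ≤ N) (h : IsZeroEnum n N z) :
    IsZeroEnum n N fun i => N - z (n + 1 - i) := by
  obtain ⟨h1, h2, h3⟩ := h
  have hmem : ∀ i ∈ Finset.Icc 1 n, n + 1 - i ∈ Finset.Icc 1 n := by
    intro i hi
    rw [Finset.mem_Icc] at hi ⊢
    omega
  refine ⟨fun i hi => ?_, fun i hi j hj hij => ?_, fun x hx => ?_⟩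
  · obtain ⟨⟨h0, hN⟩, hz⟩ := h1 _ (hmem i hi)
    exact ⟨⟨by linarith, by linarith⟩, tcheb_sub_eq_zero hn hz⟩
  · have := h2 _ (hmem j hj) _ (hmem i hi) (by simp only [Finset.mem_Icc] at hi hj; omega)
    linarith
  · obtain ⟨i, hi, hxi⟩ := h3 _ (tcheb_sub_eq_zero hn hx)
    refine ⟨n + 1 - i, hmem i hi, ?_⟩
    change x = N - z (n + 1 - (n + 1 - i))
    rw [show n + 1 - (n + 1 - i) = i by rw [Finset.mem_Icc] at hi; omega, ← hxi]
    ring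

lemma pos (h : IsZeroEnum n N z) {i : ℕ} (hi : i ∈ Finset.Icc 1 n) : 0 < z i :=
  (h.1 i hi).1.1

lemma lt (h : IsZeroEnum n N z) {i j : ℕ} (hi : 1 ≤ i) (hij : i < j) (hj : j ≤ n) :
    z i < z j :=
  h.2.1 i (Finset.mem_Icc.2 ⟨hi, by omega⟩) j (Finset.mem_Icc.2 ⟨by omega, hj⟩) hij

lemma chebPoly_eq_prod (hn : n ≤ N) (h : IsZeroEnum n N z) :
    chebPoly n N = ∏ i ∈ Finset.Icc 1 n, (1 - C (z i)⁻¹ * X) := by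
  have hdeg : (∏ i ∈ Finset.Icc 1 n, (1 - C (z i)⁻¹ * X)).natDegree ≤ n := by
    refine (natDegree_prod_le _ _).trans
      ((sum_le_card_nsmul _ _ 1 fun i _ => ?_).trans (by simp))
    compute_degree
  have hinj : Set.InjOn z (Finset.Icc 1 n : Finset ℕ) := by
    intro i hi j hj hij
    rw [Finset.mem_coe] at hi hj
    rcases lt_trichotomy i j with hlt | heq | hgt
    · exact absurd hij (h.2.1 i hi j hj hlt).ne
    · exact heq
    · exact absurd hij (h.2.1 j hj i hi hgt).ne'
  have h0 : (0 : ℝ) ∉ (Finset.Icc 1 n).image z := by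
    intro h0
    obtain ⟨i, hi, hz⟩ := mem_image.1 h0
    exact (h.pos hi).ne' hz
  have hcard : #(insert 0 ((Finset.Icc 1 n).image z)) = n + 1 := by
    rw [card_insert_of_notMem h0, card_image_of_injOn hinj, Nat.card_Icc, Nat.add_sub_cancel]
  have hlt {p : ℝ[X]} (hp : p.natDegree ≤ n) :
      p.degree < #(insert 0 ((Finset.Icc 1 n).image z)) := by
    rw [hcard]
    exact (natDegree_le_iff_degree_le.1 hp).trans_lt (by exact_mod_cast Nat.lt_succ_self n)
  refine eq_of_degrees_lt_of_eval_finset_eq _ (hlt (natDegree_chebPoly_le n N)) (hlt hdeg)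
    fun x hx => ?_
  rcases mem_insert.1 hx with rfl | hx
  · rw [eval_zero_chebPoly, eval_prod]
    simp
  · obtain ⟨i, hi, rfl⟩ := mem_image.1 hx
    rw [(tcheb_eq_zero_iff hn _).1 (h.1 i hi).2, eval_prod, eq_comm]
    refine prod_eq_zero hi ?_
    simp [(h.pos hi).ne']

/-- Two distinct zeros are never contained in the same interval `[m, m + 1]`. -/
lemma not_mem_Icc (hn : n ≤ N) (h : IsZeroEnum n N z) {a b : ℕ} (ha : a ∈ Finset.Icc 1 n)
    (hb : b ∈ Finset.Icc 1 n) (hab : a ≠ b) (m : ℕ) (hza : z a ∈ Set.Icc (m : ℝ) (m + 1)) :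
    z b ∉ Set.Icc (m : ℝ) (m + 1) := by
  intro hzb
  have hb' : b ∈ (Finset.Icc 1 n).erase a := mem_erase.2 ⟨hab.symm, hb⟩
  set q : ℝ[X] := ∏ i ∈ ((Finset.Icc 1 n).erase a).erase b, (1 - C (z i)⁻¹ * X) with hq
  have hP : chebPoly n N = (1 - C (z a)⁻¹ * X) * ((1 - C (z b)⁻¹ * X) * q) := by
    rw [h.chebPoly_eq_prod hn, hq, mul_prod_erase _ (fun i => 1 - C (z i)⁻¹ * X) hb',
      mul_prod_erase _ (fun i => 1 - C (z i)⁻¹ * X) ha]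
  have hqdeg : q.degree < n := by
    refine degree_le_natDegree.trans_lt ?_
    have : q.natDegree ≤ #(((Finset.Icc 1 n).erase a).erase b) := by
      refine (natDegree_prod_le _ _).trans
        ((sum_le_card_nsmul _ _ 1 fun i _ => ?_).trans (by simp))
      compute_degree
    rw [card_erase_of_mem hb', card_erase_of_mem ha, Nat.card_Icc] at this
    rw [Finset.mem_Icc] at ha
    exact_mod_cast (by omega : q.natDegree < n)
  have hterm (x : ℕ) : 0 ≤ (chebPoly n N).eval (x : ℝ) * q.eval (x : ℝ) := by
    have hab' : 0 ≤ (1 - (z a)⁻¹ * x) * (1 - (z b)⁻¹ * x) := by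
      rw [inv_mul_eq_div, inv_mul_eq_div, one_sub_div (h.pos ha).ne', one_sub_div (h.pos hb).ne',
        div_mul_div_comm]
      refine div_nonneg ?_ (mul_pos (h.pos ha) (h.pos hb)).le
      rcases le_or_gt x m with hx | hx
      · have hx' : (x : ℝ) ≤ m := by exact_mod_cast hx
        exact mul_nonneg (by linarith [hza.1]) (by linarith [hzb.1])
      · have hx' : (m : ℝ) + 1 ≤ x := by exact_mod_cast hx
        exact mul_nonneg_of_nonpos_of_nonpos (by linarith [hza.2]) (by linarith [hzb.2])
    rw [hP]
    simp only [eval_mul, eval_sub, eval_one, eval_C, eval_X]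
    nlinarith [mul_nonneg hab' (sq_nonneg (q.eval (x : ℝ)))]
  have h0 := (sum_eq_zero_iff_of_nonneg fun x _ => hterm x).1
    (sum_eval_chebPoly_mul_eval hn hqdeg) 0 (by simp)
  have hq0 : q.eval 0 = 1 := by
    rw [hq, eval_prod]
    simp
  rw [Nat.cast_zero, eval_zero_chebPoly, hq0] at h0
  norm_num at h0

/-- Sign changes at the first integers confine the first zeros to consecutive unit intervals. -/
lemma mem_Ioo (hn : n ≤ N) (h : IsZeroEnum n N z) {s : ℕ}
    (hsign : ∀ j < s, (chebPoly n N).eval (j : ℝ) * (chebPoly n N).eval ((j : ℝ) + 1) < 0) :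
    ∀ i < s, i + 1 ≤ n ∧ z (i + 1) ∈ Set.Ioo (i : ℝ) (i + 1) := by
  have hex : ∀ j < s, ∃ g ∈ Finset.Icc 1 n, z g ∈ Set.Ioo (j : ℝ) (j + 1) := by
    intro j hj
    have hcont : ContinuousOn (fun x => (chebPoly n N).eval x) (Set.Icc (j : ℝ) (j + 1)) :=
      (chebPoly n N).continuous.continuousOn
    have hle : (j : ℝ) ≤ j + 1 := by linarith
    obtain ⟨y, hy, hy0⟩ : ∃ y ∈ Set.Ioo (j : ℝ) (j + 1), (chebPoly n N).eval y = 0 := by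
      rcases mul_neg_iff.1 (hsign j hj) with hs | hs
      · exact intermediate_value_Ioo' hle hcont ⟨hs.2, hs.1⟩
      · exact intermediate_value_Ioo hle hcont ⟨hs.1, hs.2⟩
    obtain ⟨g, hg, rfl⟩ := h.2.2 y ((tcheb_eq_zero_iff hn y).2 hy0)
    exact ⟨g, hg, hy⟩
  intro i
  induction i with
  | zero =>
    intro hi
    obtain ⟨g, hg, hzg⟩ := hex 0 hi
    have hg' := Finset.mem_Icc.1 hg
    rcases hg'.1.eq_or_lt with rfl | hlt
    · exact ⟨hg'.2, hzg⟩
    · have h1 : 1 ∈ Finset.Icc 1 n := Finset.mem_Icc.2 ⟨le_rfl, by omega⟩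
      refine absurd (Set.Ioo_subset_Icc_self hzg) (h.not_mem_Icc hn h1 hg hlt.ne 0 ⟨?_, ?_⟩)
      · simpa using (h.pos h1).le
      · exact ((h.lt le_rfl hlt hg'.2).trans hzg.2).le
  | succ i ih =>
    intro hi
    obtain ⟨hin, hzi⟩ := ih (by omega)
    obtain ⟨g, hg, hzg⟩ := hex (i + 1) hi
    have hg' := Finset.mem_Icc.1 hg
    push_cast at hzg ⊢
    have hig : i + 1 < g := by
      by_contra! hle
      have : z g ≤ z (i + 1) := by
        rcases hle.eq_or_lt with rfl | hlt
        · exact le_rfl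
        · exact (h.lt hg'.1 hlt hin).le
      linarith [hzi.2, hzg.1]
    rcases (Nat.succ_le_of_lt hig).eq_or_lt with rfl | hlt
    · exact ⟨hg'.2, hzg⟩
    · have h1 : i + 1 ∈ Finset.Icc 1 n := Finset.mem_Icc.2 ⟨by omega, hin⟩
      have h2 : i + 2 ∈ Finset.Icc 1 n := Finset.mem_Icc.2 ⟨by omega, by omega⟩
      have hlt1 : z (i + 1) < z (i + 2) := h.lt (by omega) (by omega) (by omega)
      have hlt2 : z (i + 2) < z g := h.lt (by omega) hlt hg'.2
      rcases le_total (z (i + 2)) (i + 1) with hle | hle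
      · exact absurd ⟨(hzi.1.trans hlt1).le, hle⟩
          (h.not_mem_Icc hn h1 h2 (by omega) i (Set.Ioo_subset_Icc_self hzi))
      · refine absurd ⟨?_, ?_⟩ (h.not_mem_Icc hn hg h2 hlt.ne' (i + 1) ⟨?_, ?_⟩) <;> push_cast
        exacts [hzg.1.le, hzg.2.le, hle, (hlt2.trans hzg.2).le]

lemma sub_mul_abs_eval_le (hn : n ≤ N) (h : IsZeroEnum n N z) {j : ℕ} (hjn : j + 2 ≤ n)
    (hz : z (j + 1) ∈ Set.Ioo (j : ℝ) (j + 1)) (hz' : (j : ℝ) + 1 < z (j + 2))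
    (hsmall : 1 ≤ j → z j ≤ j - 1 / 2) :
    (z (j + 1) - j) * |(chebPoly n N).eval ((j : ℝ) + 1)| ≤
      3 ^ j * |(chebPoly n N).eval (j : ℝ)| := by
  have hδ : 0 < z (j + 1) - j := sub_pos.2 hz.1
  set c : ℕ → ℝ := fun i => (if i ≤ j then 3 else 1) * (if i = j + 1 then (z (j + 1) - j)⁻¹ else 1)
    with hc
  have hcprod : ∏ i ∈ Finset.Icc 1 n, c i = 3 ^ j * (z (j + 1) - j)⁻¹ := by
    rw [hc, prod_mul_distrib, prod_ite_eq', if_pos (Finset.mem_Icc.2 ⟨by omega, by omega⟩),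
      prod_ite, prod_const, prod_const_one, mul_one]
    have : filter (fun i => i ≤ j) (Finset.Icc 1 n) = Finset.Icc 1 j := by
      ext i
      simp only [Finset.mem_filter, Finset.mem_Icc]
      omega
    rw [this, Nat.card_Icc, Nat.add_sub_cancel]
  have heval (x : ℝ) : |(chebPoly n N).eval x| = ∏ i ∈ Finset.Icc 1 n, |1 - (z i)⁻¹ * x| := by
    rw [h.chebPoly_eq_prod hn, eval_prod, abs_prod]
    simp
  have hfac : ∀ i ∈ Finset.Icc 1 n, |1 - (z i)⁻¹ * ((j : ℝ) + 1)| ≤ c i * |1 - (z i)⁻¹ * j| := by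
    intro i hi
    have hpos := h.pos hi
    obtain ⟨hi1, hin⟩ := Finset.mem_Icc.1 hi
    rw [inv_mul_eq_div, inv_mul_eq_div, one_sub_div hpos.ne', one_sub_div hpos.ne', abs_div,
      abs_div, ← mul_div_assoc]
    refine div_le_div_of_nonneg_right ?_ (abs_nonneg _)
    rcases lt_trichotomy i (j + 1) with hlt | rfl | hgt
    · have hzi : z i ≤ j - 1 / 2 := by
        refine le_trans ?_ (hsmall (by omega))
        rcases (Nat.lt_succ_iff.1 hlt).eq_or_lt with rfl | hlt'
        · exact le_rfl
        · exact (h.lt hi1 hlt' (by omega)).le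
      simp only [hc, if_pos (Nat.lt_succ_iff.1 hlt), if_neg hlt.ne]
      rw [abs_of_neg (by linarith), abs_of_neg (by linarith)]
      linarith
    · simp only [hc, if_neg (Nat.not_succ_le_self j), if_true]
      rw [abs_of_pos hδ, one_mul, inv_mul_cancel₀ hδ.ne', abs_le]
      constructor <;> linarith [hz.1, hz.2]
    · have hzi : (j : ℝ) + 1 < z i := by
        rcases (Nat.succ_le_of_lt hgt).eq_or_lt with rfl | hlt'
        · exact hz'
        · exact hz'.trans (h.lt (by omega) hlt' hin)
      simp only [hc, if_neg (show ¬ i ≤ j by omega), if_neg hgt.ne']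
      rw [abs_of_pos (by linarith), abs_of_pos (by linarith)]
      linarith
  calc
    _ ≤ (z (j + 1) - j) * ∏ i ∈ Finset.Icc 1 n, (c i * |1 - (z i)⁻¹ * j|) := by
      rw [heval]
      exact mul_le_mul_of_nonneg_left (prod_le_prod (fun _ _ => abs_nonneg _) hfac) hδ.le
    _ = _ := by
      rw [prod_mul_distrib, hcprod, ← heval]
      field_simp

end IsZeroEnum

lemma tendsto_poch_div_pow {u : ℕ → ℝ} {c : ℝ}
    (hu : Tendsto (fun N : ℕ => u N / N) atTop (𝓝 c)) (k : ℕ) :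
    Tendsto (fun N : ℕ => poch (u N) k / (N : ℝ) ^ k) atTop (𝓝 (c ^ k)) := by
  have h : Tendsto (fun N : ℕ => ∏ i ∈ range k, (u N / N + i / N)) atTop
      (𝓝 (∏ _i ∈ range k, (c + 0))) :=
    tendsto_finsetProd _ fun i _ => hu.add (tendsto_const_div_atTop_nhds_zero_nat _)
  simpa [poch, ← add_div, prod_div_distrib] using h

lemma tendsto_floor_mul_div {b : ℝ} (hb : 0 ≤ b) :
    Tendsto (fun N : ℕ => (⌊b * (N : ℝ)⌋₊ : ℝ) / N) atTop (𝓝 b) :=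
  (tendsto_nat_floor_mul_div_atTop hb).comp tendsto_natCast_atTop_atTop

lemma tendsto_eval_chebPoly_div_pow {b : ℝ} (hb : 0 < b) (j : ℕ) :
    Tendsto (fun N : ℕ => (chebPoly ⌊b * (N : ℝ)⌋₊ N).eval (j : ℝ) / (N : ℝ) ^ j) atTop
      (𝓝 ((-1) ^ j * (b ^ 2) ^ j / j.factorial)) := by
  have hn := tendsto_floor_mul_div hb.le
  have hneg : Tendsto (fun N : ℕ => -(⌊b * (N : ℝ)⌋₊ : ℝ) / N) atTop (𝓝 (-b)) := by
    simpa [neg_div] using hn.neg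
  have hsucc : Tendsto (fun N : ℕ => ((⌊b * (N : ℝ)⌋₊ : ℝ) + 1) / N) atTop (𝓝 b) := by
    simpa [add_div] using hn.add (tendsto_const_div_atTop_nhds_zero_nat 1)
  have hN : Tendsto (fun N : ℕ => -(N : ℝ) / N) atTop (𝓝 (-1)) := by
    refine tendsto_const_nhds.congr' ?_
    filter_upwards [eventually_ne_atTop 0] with N hN
    rw [neg_div, div_self (by exact_mod_cast hN)]
  have hterm (k : ℕ) := (((tendsto_poch_div_pow hneg k).mul (tendsto_poch_div_pow hsucc k)).div
    (tendsto_poch_div_pow hN k) (pow_ne_zero k (by norm_num))).mul_const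
      (poch (-(j : ℝ)) k / (k.factorial : ℝ) ^ 2)
  have hsum := tendsto_finsetSum (range (j + 1)) fun k _ => (hterm k).mul
    ((tendsto_inv_atTop_nhds_zero_nat (𝕜 := ℝ)).pow (j - k))
  have hlim : ∑ k ∈ range (j + 1), (-b) ^ k * b ^ k / (-1) ^ k *
      (poch (-(j : ℝ)) k / (k.factorial : ℝ) ^ 2) * 0 ^ (j - k) =
      (-1) ^ j * (b ^ 2) ^ j / j.factorial := by
    rw [sum_range_succ, sum_eq_zero, poch_neg_natCast, Nat.descFactorial_self, Nat.sub_self,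
      neg_pow b]
    · field_simp
      ring
    · intro k hk
      rw [zero_pow (Nat.sub_ne_zero_of_lt (mem_range.1 hk)), mul_zero]
  rw [hlim] at hsum
  refine hsum.congr' ?_
  have hlarge : ∀ᶠ N : ℕ in atTop, j ≤ ⌊b * (N : ℝ)⌋₊ :=
    (tendsto_nat_floor_atTop.comp
      (tendsto_natCast_atTop_atTop.const_mul_atTop hb)).eventually_ge_atTop j
  filter_upwards [hlarge, eventually_ne_atTop 0] with N hjn hN0
  have hN0' : (N : ℝ) ≠ 0 := by exact_mod_cast hN0
  rw [eval_chebPoly, sum_div]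
  have hsub : range (j + 1) ⊆ range (⌊b * (N : ℝ)⌋₊ + 1) := range_subset_range.2 (by omega)
  rw [← sum_subset hsub]
  · refine sum_congr rfl fun k hk => ?_
    obtain ⟨d, rfl⟩ := Nat.exists_eq_add_of_le (Nat.lt_succ_iff.1 (mem_range.1 hk))
    rw [Nat.add_sub_cancel_left, pow_add]
    simp only [Pi.div_apply, inv_pow]
    field_simp
  · intro k _ hk
    have : (j.descFactorial k) = 0 :=
      Nat.descFactorial_eq_zero_iff_lt.2 (by simpa using hk)
    simp [poch_neg_natCast j k, this]

lemma eventually_eval_chebPoly_mul_neg {b : ℝ} (hb : 0 < b) (j : ℕ) :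
    ∀ᶠ N : ℕ in atTop, (chebPoly ⌊b * (N : ℝ)⌋₊ N).eval (j : ℝ) *
      (chebPoly ⌊b * (N : ℝ)⌋₊ N).eval ((j : ℝ) + 1) < 0 := by
  have h := (tendsto_eval_chebPoly_div_pow hb j).mul (tendsto_eval_chebPoly_div_pow hb (j + 1))
  have hlim : (-1) ^ j * (b ^ 2) ^ j / (j.factorial : ℝ) *
      ((-1) ^ (j + 1) * (b ^ 2) ^ (j + 1) / ((j + 1).factorial : ℝ)) < 0 := by
    have h1 : ((-1 : ℝ) ^ j) * (-1) ^ j = 1 := by rw [← mul_pow]; simp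
    have h2 : 0 < (b ^ 2) ^ j / (j.factorial : ℝ) * ((b ^ 2) ^ (j + 1) / (j + 1).factorial) := by
      positivity
    calc
      _ = -((b ^ 2) ^ j / (j.factorial : ℝ) * ((b ^ 2) ^ (j + 1) / (j + 1).factorial)) *
          ((-1 : ℝ) ^ j * (-1) ^ j) := by ring
      _ < 0 := by rw [h1]; linarith
  filter_upwards [h.eventually_lt_const hlim, eventually_gt_atTop 0] with N hlt hN
  have hN' : (0 : ℝ) < N := by exact_mod_cast hN
  rw [div_mul_div_comm, div_neg_iff] at hlt
  push_cast at hlt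
  rcases hlt with hlt | hlt
  · exact absurd hlt.2 (not_lt.2 (by positivity))
  · exact hlt.1

lemma tendsto_eval_chebPoly_ratio {b : ℝ} (hb : 0 < b) (j : ℕ) :
    Tendsto (fun N : ℕ => |(chebPoly ⌊b * (N : ℝ)⌋₊ N).eval (j : ℝ)| /
      |(chebPoly ⌊b * (N : ℝ)⌋₊ N).eval ((j : ℝ) + 1)|) atTop (𝓝 0) := by
  have h := (((tendsto_eval_chebPoly_div_pow hb j).div (tendsto_eval_chebPoly_div_pow hb (j + 1))
    (by positivity)).mul (tendsto_inv_atTop_nhds_zero_nat (𝕜 := ℝ))).abs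
  rw [mul_zero, abs_zero] at h
  refine h.congr' ?_
  filter_upwards [eventually_ne_atTop 0] with N hN
  have hN' : (N : ℝ) ≠ 0 := by exact_mod_cast hN
  rw [← abs_div]
  congr 1
  simp only [Pi.div_apply]
  push_cast
  rw [pow_succ]
  field_simp

lemma floor_mul_natCast_le {b : ℝ} (hb : b ≤ 1) (N : ℕ) : ⌊b * (N : ℝ)⌋₊ ≤ N := by
  refine Nat.floor_le_of_le ?_
  nlinarith [Nat.cast_nonneg (α := ℝ) N]

/-- For fixed `j`, the `(j + 1)`-st smallest zero of `t_n(·, N+1)` tends to `j`. -/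
theorem tendsto_of_isZeroEnum {b : ℝ} (hb : b ∈ Set.Ioo (0 : ℝ) 1) {z : ℕ → ℕ → ℝ}
    (h : ∀ᶠ N : ℕ in atTop, IsZeroEnum ⌊b * (N : ℝ)⌋₊ N (z N)) (j : ℕ) :
    Tendsto (fun N => z N (j + 1)) atTop (𝓝 (j : ℝ)) := by
  have step (j : ℕ) (hsmall : ∀ᶠ N in atTop, 1 ≤ j → z N j ≤ j - 1 / 2) :
      Tendsto (fun N => z N (j + 1)) atTop (𝓝 (j : ℝ)) := by
    have hsign : ∀ᶠ N : ℕ in atTop, ∀ i ∈ range (j + 2),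
        (chebPoly ⌊b * (N : ℝ)⌋₊ N).eval (i : ℝ) *
          (chebPoly ⌊b * (N : ℝ)⌋₊ N).eval ((i : ℝ) + 1) < 0 :=
      (Filter.eventually_all_finset _).2 fun i _ => eventually_eval_chebPoly_mul_neg hb.1 i
    have hupper : Tendsto (fun N : ℕ => (j : ℝ) + 3 ^ j *
        (|(chebPoly ⌊b * (N : ℝ)⌋₊ N).eval (j : ℝ)| /
          |(chebPoly ⌊b * (N : ℝ)⌋₊ N).eval ((j : ℝ) + 1)|)) atTop (𝓝 j) := by
      simpa using ((tendsto_eval_chebPoly_ratio hb.1 j).const_mul (3 ^ j)).const_add (j : ℝ)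
    have hbounds : ∀ᶠ N : ℕ in atTop, (j : ℝ) ≤ z N (j + 1) ∧ z N (j + 1) ≤ (j : ℝ) + 3 ^ j *
        (|(chebPoly ⌊b * (N : ℝ)⌋₊ N).eval (j : ℝ)| /
          |(chebPoly ⌊b * (N : ℝ)⌋₊ N).eval ((j : ℝ) + 1)|) := by
      filter_upwards [h, hsign, hsmall] with N hN hs hsm
      have hn := floor_mul_natCast_le hb.2.le N
      have hloc := hN.mem_Ioo hn fun i hi => hs i (mem_range.2 hi)
      have hz := (hloc j (by omega)).2
      obtain ⟨hjn, hz'⟩ := hloc (j + 1) (by omega)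
      push_cast at hz'
      have hle := hN.sub_mul_abs_eval_le hn hjn hz hz'.1 hsm
      have hpos := abs_pos.2 (right_ne_zero_of_mul (hs j (mem_range.2 (by omega))).ne)
      rw [← le_div_iff₀ hpos, mul_div_assoc] at hle
      exact ⟨hz.1.le, by linarith⟩
    exact tendsto_of_tendsto_of_tendsto_of_le_of_le' tendsto_const_nhds hupper
      (hbounds.mono fun _ hN => hN.1) (hbounds.mono fun _ hN => hN.2)
  induction j with
  | zero => exact step 0 (Eventually.of_forall fun N h0 => absurd h0 (by omega))
  | succ j ih =>
    refine step (j + 1) ?_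
    filter_upwards [ih.eventually_le_const (show (j : ℝ) < j + 1 / 2 by linarith)] with N hN _
    push_cast
    linarith

end DiscreteChebyshev

/-- (i) Zeros of `t_n(·, N+1)` are symmetric about `N/2`; (ii) if, for all sufficiently
large `N`, the polynomial `t_n(·, N+1)` with `n = ⌊bN⌋` has `n` distinct zeros
`x_{N+1,1} < ⋯ < x_{N+1,n}` in `(0, N)`, then the `s`-th smallest zero tends to `s-1`,
and the `s`-th largest zero satisfies `N - x_{N+1,n-s+1} → s-1`, as `N → ∞`. -/
theorem tcheb_zeros (b : ℝ) (hb : b ∈ Set.Ioo (0 : ℝ) 1) (s : ℕ) (hs : 1 ≤ s)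
    (z : ℕ → ℕ → ℝ) :
    (∀ n N : ℕ, n ≤ N → ∀ x : ℝ, tcheb n N x = 0 → tcheb n N ((N : ℝ) - x) = 0) ∧
    ((∀ᶠ N : ℕ in atTop,
        (∀ i ∈ Finset.Icc 1 (⌊b * (N : ℝ)⌋₊),
            z N i ∈ Set.Ioo (0 : ℝ) (N : ℝ) ∧ tcheb (⌊b * (N : ℝ)⌋₊) N (z N i) = 0) ∧
        (∀ i ∈ Finset.Icc 1 (⌊b * (N : ℝ)⌋₊), ∀ j ∈ Finset.Icc 1 (⌊b * (N : ℝ)⌋₊),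
            i < j → z N i < z N j) ∧
        (∀ x : ℝ, tcheb (⌊b * (N : ℝ)⌋₊) N x = 0 →
            ∃ i ∈ Finset.Icc 1 (⌊b * (N : ℝ)⌋₊), x = z N i)) →
      Tendsto (fun N : ℕ => z N s) atTop (nhds ((s : ℝ) - 1)) ∧
      Tendsto (fun N : ℕ => (N : ℝ) - z N (⌊b * (N : ℝ)⌋₊ - s + 1)) atTop
        (nhds ((s : ℝ) - 1))) := by
  refine ⟨fun n N hn x hx => tcheb_sub_eq_zero hn hx, fun h => ?_⟩
  obtain ⟨j, rfl⟩ := Nat.exists_eq_add_of_le' hs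
  have hz : ∀ᶠ N : ℕ in atTop, IsZeroEnum ⌊b * (N : ℝ)⌋₊ N (z N) := h
  rw [Nat.cast_add_one, add_sub_cancel_right]
  refine ⟨tendsto_of_isZeroEnum hb hz j, ?_⟩
  have hlarge : ∀ᶠ N : ℕ in atTop, j + 1 ≤ ⌊b * (N : ℝ)⌋₊ :=
    (tendsto_nat_floor_atTop.comp
      (tendsto_natCast_atTop_atTop.const_mul_atTop hb.1)).eventually_ge_atTop (j + 1)
  refine (tendsto_of_isZeroEnum hb
    (hz.mono fun N hN => hN.reflect (floor_mul_natCast_le hb.2.le N)) j).congr' ?_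
  filter_upwards [hlarge] with N hN
  rw [Nat.sub_add_comm hN]
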